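/- Define the polynomials F_m by F₀ = 1, F₁ = Y − X, and F_{m+2} = (Y − 2X)·F_{m+1} − X²·F_m for m ≥ 0. Then: (1) there is no prime p and integer Y with F_{21933}(p^17, Y) = 43867 or F_{21933}(p^17, Y) = −43867; and (2) there is no prime p and integer Y with F_{328965}(p^25, Y) = 657931 or F_{328965}(p^25, Y) = −657931. -/

import Mathlib

/-- The degree-`m` Thue forms of the paper (there denoted `F_{2m}(X,Y)`), defined over any
commutative ring by `F₀ = 1`, `F₁ = Y − X`, `F_{m+2} = (Y − 2X)·F_{m+1} − X²·F_m`. -/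
def ThueF {R : Type*} [CommRing R] (X Y : R) : ℕ → R
  | 0 => 1
  | 1 => Y - X
  | (m + 2) => (Y - 2 * X) * ThueF X Y (m + 1) - X ^ 2 * ThueF X Y m

section
open Matrix

theorem Complex.eq_sum_iterate_dslope_add (f : ℂ → ℂ) (n : ℕ) (z : ℂ) :
    f z = ∑ i ∈ Finset.range n, ((fun g : ℂ → ℂ => dslope g 0)^[i] f) 0 * z ^ i +
      z ^ n * ((fun g : ℂ → ℂ => dslope g 0)^[n] f) z := by
  induction n with
  | zero => simp
  | succ n ih =>
    rw [Finset.sum_range_succ, Function.iterate_succ_apply']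
    have h := sub_smul_dslope ((fun g : ℂ → ℂ => dslope g 0)^[n] f) 0 z
    simp only [sub_zero, smul_eq_mul] at h
    rw [pow_succ, mul_assoc, h]
    linear_combination ih

theorem Complex.differentiable_iterate_dslope {f : ℂ → ℂ} (hf : Differentiable ℂ f) (n : ℕ) :
    Differentiable ℂ ((fun g : ℂ → ℂ => dslope g 0)^[n] f) := by
  induction n with
  | zero => simpa
  | succ n ih =>
    rw [Function.iterate_succ_apply']
    rw [← differentiableOn_univ] at ih ⊢
    exact (Complex.differentiableOn_dslope Filter.univ_mem).2 ih

theorem Matrix.norm_det_le_factorial_mul_prod {n : Type*} [Fintype n] [DecidableEq n]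
    (M : Matrix n n ℂ) (C : n → ℝ) (hC : ∀ i j, ‖M i j‖ ≤ C j) :
    ‖M.det‖ ≤ (Fintype.card n).factorial * ∏ j, C j := by
  rw [det_apply]
  refine (norm_sum_le _ _).trans ?_
  have h : ∀ σ ∈ (Finset.univ : Finset (Equiv.Perm n)),
      ‖Equiv.Perm.sign σ • ∏ i, M (σ i) i‖ ≤ ∏ j, C j := by
    intro σ _
    have : ‖Equiv.Perm.sign σ • ∏ i, M (σ i) i‖ = ∏ i, ‖M (σ i) i‖ := by
      rcases Int.units_eq_one_or (Equiv.Perm.sign σ) with h | h <;> simp [h]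
    rw [this]
    exact Finset.prod_le_prod (fun _ _ => norm_nonneg _) fun i _ => hC _ _
  refine (Finset.sum_le_card_nsmul _ _ _ h).trans ?_
  rw [Finset.card_univ, Fintype.card_perm, nsmul_eq_mul]

theorem Matrix.differentiable_det {n : Type*} [Fintype n] [DecidableEq n]
    {M : ℂ → Matrix n n ℂ} (hM : ∀ i j, Differentiable ℂ fun z => M z i j) :
    Differentiable ℂ fun z => (M z).det := by
  simp only [det_apply]
  refine Differentiable.fun_sum fun σ _ => ?_
  refine Differentiable.const_smul ?_ (Equiv.Perm.sign σ)
  exact Differentiable.fun_finsetProd fun i _ => hM _ _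

/-- A Schwarz lemma for interpolation determinants whose entries are slightly perturbed. -/
theorem norm_det_interpolation_le {n : ℕ} {a : Fin n → ℂ} (ha : Function.Injective a)
    {f : Fin n → ℂ → ℂ} (hf : ∀ c, Differentiable ℂ (f c)) (B : Matrix (Fin n) (Fin n) ℂ)
    {ρ : ℝ} (hρ : 1 ≤ ρ) {C : Fin n → ℝ}
    (hC : ∀ i c z, ‖z‖ = ρ → ‖f c (z * a i)‖ + ρ ^ n * ‖B i c‖ ≤ C c) :
    ‖(of fun i c => f c (a i) + B i c).det‖ * ρ ^ (∑ i : Fin n, (i : ℕ)) ≤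
      n.factorial * ∏ c, C c := by
  set V : Matrix (Fin n) (Fin n) ℂ := vandermonde a with hV
  have hVdet : IsUnit V.det := isUnit_iff_ne_zero.2 (det_vandermonde_ne_zero_iff.2 ha)
  let F : Matrix (Fin n) (Fin n) ℂ := of fun j c => (fun g : ℂ → ℂ => dslope g 0)^[(j : ℕ)] (f c) 0
  let E : ℂ → Matrix (Fin n) (Fin n) ℂ := fun z =>
    of fun i c => a i ^ n * (fun g : ℂ → ℂ => dslope g 0)^[n] (f c) (z * a i) + B i c
  let D : ℂ → Matrix (Fin n) (Fin n) ℂ := fun z => diagonal fun j => z ^ (n - (j : ℕ))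
  let G : ℂ → Matrix (Fin n) (Fin n) ℂ := fun z => F + D z * (V⁻¹ * E z)
  let H : ℂ → Matrix (Fin n) (Fin n) ℂ := fun z => of fun i c => f c (z * a i) + z ^ n * B i c
  have hfac : ∀ z, H z = V * ((diagonal fun j : Fin n => z ^ (j : ℕ)) * G z) := by
    intro z
    have h1 : (diagonal fun j : Fin n => z ^ (j : ℕ)) * D z = z ^ n • (1 : Matrix _ _ ℂ) := by
      rw [diagonal_mul_diagonal, smul_one_eq_diagonal]
      congr 1
      ext j
      rw [← pow_add]
      congr 1
      have := j.2
      omega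
    have h2 : V * ((diagonal fun j : Fin n => z ^ (j : ℕ)) * G z) =
        V * (diagonal fun j : Fin n => z ^ (j : ℕ)) * F + z ^ n • E z := by
      simp only [G]
      rw [mul_add, mul_add, ← mul_assoc, ← mul_assoc (diagonal _) (D z), h1, Matrix.smul_mul, one_mul,
        Matrix.mul_smul, ← mul_assoc V, mul_nonsing_inv V hVdet, one_mul]
    rw [h2]
    ext i c
    simp only [H, E, of_apply, Matrix.add_apply, Matrix.smul_apply, smul_eq_mul, F]
    rw [mul_apply]
    simp only [mul_diagonal, hV, vandermonde_apply, of_apply]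
    rw [Complex.eq_sum_iterate_dslope_add (f c) n (z * a i), Finset.sum_range]
    have : ∀ j : Fin n, ((fun g : ℂ → ℂ => dslope g 0)^[(j : ℕ)] (f c)) 0 * (z * a i) ^ (j : ℕ) =
        a i ^ (j : ℕ) * z ^ (j : ℕ) * ((fun g : ℂ → ℂ => dslope g 0)^[(j : ℕ)] (f c)) 0 := by
      intro j; ring
    simp only [this]
    ring
  have hdet : ∀ z, (H z).det = z ^ (∑ i : Fin n, (i : ℕ)) * (V.det * (G z).det) := by
    intro z
    rw [hfac, det_mul, det_mul, det_diagonal, Finset.prod_pow_eq_pow_sum]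
    ring
  have hGdiff : Differentiable ℂ fun z => V.det * (G z).det := by
    refine (Matrix.differentiable_det fun i c => ?_).const_mul _
    simp only [G, D, Matrix.add_apply, diagonal_mul]
    simp only [mul_apply, E, of_apply]
    refine (differentiable_const _).add (Differentiable.mul (by fun_prop) ?_)
    refine Differentiable.fun_sum fun k _ => ?_
    refine Differentiable.const_mul ?_ _
    refine Differentiable.add (Differentiable.const_mul ?_ _) (differentiable_const _)
    exact (Complex.differentiable_iterate_dslope (hf c) n).comp (by fun_prop)
  have hρ0 : 0 < ρ := by linarith
  have hmax : ‖V.det * (G 1).det‖ ≤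
      (n.factorial * ∏ c, C c) / ρ ^ (∑ i : Fin n, (i : ℕ)) := by
    refine Complex.norm_le_of_forall_mem_frontier_norm_le (f := fun z => V.det * (G z).det)
      (U := Metric.ball 0 ρ) Metric.isBounded_ball hGdiff.diffContOnCl (fun z hz => ?_)
      (by simpa [closure_ball (0 : ℂ) hρ0.ne'] using hρ)
    rw [frontier_ball 0 hρ0.ne', mem_sphere_zero_iff_norm] at hz
    rw [le_div_iff₀ (by positivity)]
    have h3 : ‖(H z).det‖ ≤ n.factorial * ∏ c, C c := by
      have := Matrix.norm_det_le_factorial_mul_prod (H z) C fun i c => by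
        refine (norm_add_le _ _).trans ?_
        rw [norm_mul, norm_pow, hz]
        exact hC i c z hz
      simpa using this
    rw [hdet, norm_mul, norm_pow, hz] at h3
    linarith
  rw [le_div_iff₀ (by positivity)] at hmax
  have h1 : (of fun i c => f c (a i) + B i c).det = V.det * (G 1).det := by
    have := hdet 1
    simp only [H, one_mul, one_pow] at this
    exact this
  rw [h1]
  exact hmax
end

section
open Matrix Polynomial

theorem Polynomial.coeff_prod_sum_of_natDegree_le {R ι : Type*} [CommRing R] (s : Finset ι)
    (f : ι → R[X]) (d : ι → ℕ) (h : ∀ i ∈ s, (f i).natDegree ≤ d i) :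
    (∏ i ∈ s, f i).coeff (∑ i ∈ s, d i) = ∏ i ∈ s, (f i).coeff (d i) := by
  classical
  induction s using Finset.induction_on with
  | empty => simp
  | insert a s ha ih =>
    have h' : ∀ i ∈ s, (f i).natDegree ≤ d i := fun i hi => h i (Finset.mem_insert_of_mem hi)
    rw [Finset.prod_insert ha, Finset.sum_insert ha, Finset.prod_insert ha,
      coeff_mul_add_eq_of_natDegree_le (h a (Finset.mem_insert_self _ _))
        ((natDegree_prod_le _ _).trans (Finset.sum_le_sum h')), ih h']

theorem Polynomial.coeff_det_sum_of_natDegree_le {R n : Type*} [CommRing R] [Fintype n]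
    [DecidableEq n] (M : Matrix n n R[X]) (d : n → ℕ) (h : ∀ i j, (M i j).natDegree ≤ d j) :
    M.det.coeff (∑ j, d j) = (of fun i j => (M i j).coeff (d j)).det := by
  simp only [det_apply, finsetSum_coeff]
  refine Finset.sum_congr rfl fun σ _ => ?_
  rw [coeff_smul, coeff_prod_sum_of_natDegree_le _ _ _ fun i _ => h _ _]
  rfl

theorem Polynomial.natDegree_det_le_sum {R n : Type*} [CommRing R] [Fintype n]
    [DecidableEq n] (M : Matrix n n R[X]) (d : n → ℕ) (h : ∀ i j, (M i j).natDegree ≤ d j) :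
    M.det.natDegree ≤ ∑ j, d j := by
  rw [det_apply]
  refine natDegree_sum_le_of_forall_le _ _ fun σ _ => (natDegree_smul_le _ _).trans ?_
  exact (natDegree_prod_le _ _).trans (Finset.sum_le_sum fun i _ => h _ _)

theorem exists_sum_eval_mul_pow_ne_zero {n R S K : ℕ} (hn : 0 < n) (P : Fin n → ℂ[X])
    (hP : ∀ l, P l ≠ 0) (hK : ∀ l, (P l).natDegree ≤ K) (m : Fin n → ℕ) {ω b : ℂ}
    (hω : Function.Injective fun l => ω ^ m l) {x y : ℕ → ℕ → ℂ} (hy : ∀ r s, y r s ≠ 0)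
    (hxr : ∀ r s u : ℕ, x (r + u) s = x r s + u * b)
    (hyr : ∀ r s u : ℕ, y (r + u) s = ω ^ u * y r s)
    (hx : Function.Injective fun q : Fin R × Fin S => x q.1 q.2) (hRS : n * K < R * S) :
    ∃ r s : ℕ, r < R + n - 1 ∧ s < S ∧ ∑ l, (P l).eval (x r s) * y r s ^ m l ≠ 0 := by
  by_contra! hcon
  let M : Matrix (Fin n) (Fin n) ℂ[X] :=
    of fun u l => C ((ω ^ m l) ^ (u : ℕ)) * taylor ((u : ℕ) * b) (P l)
  have hdeg : ∀ u l, (M u l).natDegree ≤ (P l).natDegree := fun u l =>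
    (natDegree_C_mul_le _ _).trans (natDegree_taylor _ _).le
  have hne : M.det ≠ 0 := by
    intro h0
    have h1 := coeff_det_sum_of_natDegree_le M _ hdeg
    rw [h0, coeff_zero] at h1
    have h2 : (of fun u l => (M u l).coeff (P l).natDegree) =
        (vandermonde fun l => ω ^ m l)ᵀ * diagonal fun l => (P l).leadingCoeff := by
      ext u l
      simp only [M, mul_diagonal, of_apply, coeff_C_mul, coeff_taylor_natDegree, transpose_apply,
        vandermonde_apply]
    rw [h2, det_mul, det_transpose, det_diagonal] at h1
    exact mul_ne_zero (det_vandermonde_ne_zero_iff.2 hω)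
      (Finset.prod_ne_zero_iff.2 fun l _ => leadingCoeff_ne_zero.2 (hP l)) h1.symm
  refine hne (eq_zero_of_natDegree_lt_card_of_eval_eq_zero _ hx (fun q => ?_) ?_)
  · rw [← coe_evalRingHom, RingHom.map_det]
    refine exists_mulVec_eq_zero_iff.1 ⟨fun l => y q.1 q.2 ^ m l, ?_, ?_⟩
    · exact fun h => pow_ne_zero _ (hy _ _) (congrFun h ⟨0, hn⟩)
    · ext u
      have h := hcon (q.1 + u) q.2 (by omega) q.2.2
      rw [Pi.zero_apply, ← h, mulVec, dotProduct]
      refine Finset.sum_congr rfl fun l _ => ?_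
      simp only [M, RingHom.mapMatrix_apply, map_apply, of_apply, coe_evalRingHom, eval_mul, eval_C,
        taylor_eval, hxr, hyr]
      ring
  · refine (natDegree_det_le_sum M _ hdeg).trans_lt ?_
    refine (Finset.sum_le_card_nsmul _ _ K fun l _ => hK l).trans_lt ?_
    simpa using hRS

theorem eq_zero_of_sum_eval_mul_pow_eq_zero {L R S K : ℕ} (P : Fin L → ℂ[X])
    (hK : ∀ l, (P l).natDegree ≤ K) {ω b : ℂ}
    (hω : Function.Injective fun l : Fin L => ω ^ (l : ℕ)) {x y : ℕ → ℕ → ℂ}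
    (hy : ∀ r s, y r s ≠ 0) (hxr : ∀ r s u : ℕ, x (r + u) s = x r s + u * b)
    (hyr : ∀ r s u : ℕ, y (r + u) s = ω ^ u * y r s)
    (hx : Function.Injective fun q : Fin R × Fin S => x q.1 q.2) (hRS : L * K < R * S)
    (h : ∀ r s : ℕ, r < R + L - 1 → s < S → ∑ l, (P l).eval (x r s) * y r s ^ (l : ℕ) = 0) :
    P = 0 := by
  classical
  by_contra hP
  let T : Finset (Fin L) := Finset.univ.filter fun l => P l ≠ 0
  have hT : 0 < T.card := by
    obtain ⟨l, hl⟩ := Function.ne_iff.1 hP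
    exact Finset.card_pos.2 ⟨l, by simpa [T] using hl⟩
  have hTL : T.card ≤ L := by simpa using Finset.card_le_univ T
  let e : Fin T.card ≃ T := T.equivFin.symm
  obtain ⟨r, s, hr, hs, hrs⟩ := exists_sum_eval_mul_pow_ne_zero hT (fun i => P (e i))
    (fun i => (Finset.mem_filter.1 (e i).2).2) (fun i => hK _) (fun i => ((e i : Fin L) : ℕ))
    (ω := ω) (fun i j hij => e.injective (Subtype.ext (hω hij))) hy hxr hyr hx
    (lt_of_le_of_lt (Nat.mul_le_mul_right K hTL) hRS)
  refine hrs ?_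
  rw [← h r s (by omega) hs,
    e.sum_comp fun l : T => (P l).eval (x r s) * y r s ^ ((l : Fin L) : ℕ),
    Finset.sum_coe_sort T fun l => (P l).eval (x r s) * y r s ^ (l : ℕ)]
  refine Finset.sum_subset (Finset.subset_univ _) fun l _ hl => ?_
  have : P l = 0 := by simpa [T] using hl
  simp [this]

theorem Matrix.exists_submatrix_det_ne_zero {p c F : Type*} [Fintype p] [Fintype c]
    [DecidableEq c] [Field F] (A : Matrix p c F) (hA : ∀ v, A *ᵥ v = 0 → v = 0) :
    ∃ f : c → p, (A.submatrix f id).det ≠ 0 := by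
  obtain ⟨κ, a, ha, hspan, hli⟩ := exists_linearIndependent' F A.row
  have : Finite κ := Finite.of_injective a ha
  have := Fintype.ofFinite κ
  have hcard : Fintype.card κ = Fintype.card c := by
    have h1 := finrank_span_eq_card hli
    rw [hspan, ← rank_eq_finrank_span_row, rank, LinearMap.finrank_range_of_inj] at h1
    · simpa using h1.symm
    · exact (injective_iff_map_eq_zero A.mulVecLin).2 hA
  let e := Fintype.equivOfCardEq hcard.symm
  refine ⟨a ∘ e, ?_⟩
  rw [← isUnit_iff_ne_zero, ← isUnit_iff_isUnit_det, ← linearIndependent_rows_iff_isUnit]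
  exact hli.comp e e.injective
end

section
open Matrix Polynomial

/-- The polynomial `X (X - 1) ⋯ (X - k + 1) / k!`. -/
noncomputable def binomialPolynomial (k : ℕ) : ℂ[X] :=
  C ((k.factorial : ℂ)⁻¹) * descPochhammer ℂ k

theorem degree_binomialPolynomial (k : ℕ) : (binomialPolynomial k).degree = k := by
  have h : ((k.factorial : ℂ)⁻¹) ≠ 0 := inv_ne_zero (Nat.cast_ne_zero.2 k.factorial_ne_zero)
  rw [binomialPolynomial, degree_C_mul h, degree_eq_natDegree (monic_descPochhammer ℂ k).ne_zero,
    descPochhammer_natDegree]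

theorem exists_int_eval_binomialPolynomial (k : ℕ) (a : ℤ) :
    ∃ n : ℤ, (binomialPolynomial k).eval (a : ℂ) = n := by
  refine ⟨Ring.choose a k, ?_⟩
  have h1 := Ring.descPochhammer_eq_factorial_smul_choose a k
  rw [← eval_eq_smeval, nsmul_eq_mul] at h1
  have h2 : (descPochhammer ℂ k).eval (a : ℂ) = ((descPochhammer ℤ k).eval a : ℤ) := by
    rw [← descPochhammer_map (Int.castRingHom ℂ), eval_intCast_map]
    simp
  have h : (k.factorial : ℂ) ≠ 0 := Nat.cast_ne_zero.2 k.factorial_ne_zero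
  rw [binomialPolynomial, eval_mul, eval_C, h2, h1]
  push_cast
  field_simp

theorem norm_eval_binomialPolynomial_le (k : ℕ) (z : ℂ) :
    ‖(binomialPolynomial k).eval z‖ ≤ (‖z‖ + k) ^ k / k.factorial := by
  rw [binomialPolynomial, eval_mul, eval_C, norm_mul, norm_inv, Complex.norm_natCast, div_eq_inv_mul,
    descPochhammer_eval_eq_prod_range, norm_prod]
  gcongr
  refine (Finset.prod_le_prod (g := fun _ => ‖z‖ + k) (fun _ _ => norm_nonneg _)
    fun j hj => ?_).trans (by simp)
  refine (norm_sub_le _ _).trans ?_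
  rw [Complex.norm_natCast]
  have : (j : ℝ) ≤ k := by exact_mod_cast (Finset.mem_range.1 hj).le
  linarith

theorem eq_zero_of_sum_binomialPolynomial_eq_zero {K : ℕ} {v : Fin K → ℂ}
    (h : ∑ k : Fin K, C (v k) * binomialPolynomial k = 0) : v = 0 := by
  let S : Polynomial.Sequence ℂ := ⟨binomialPolynomial, degree_binomialPolynomial⟩
  have hli := S.linearIndependent.comp (fun k : Fin K => (k : ℕ)) Fin.val_injective
  rw [Fintype.linearIndependent_iff] at hli
  ext k
  exact hli v (by simpa [smul_eq_C_mul] using h) k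

theorem natDegree_sum_binomialPolynomial_le {K : ℕ} (v : Fin K → ℂ) :
    (∑ k : Fin K, C (v k) * binomialPolynomial k).natDegree ≤ K - 1 := by
  refine natDegree_sum_le_of_forall_le _ _ fun k _ => (natDegree_C_mul_le _ _).trans ?_
  rw [natDegree_eq_of_degree_eq_some (degree_binomialPolynomial k)]
  omega

theorem exists_int_of_mem_closure_singleton {μ : ℂ} {c n : ℤ} (hc : 2 * μ.re = c)
    (hn : Complex.normSq μ = n) {z : ℂ} (hz : z ∈ Subring.closure {μ}) :
    ∃ u v : ℤ, z = u + v * μ := by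
  have hμ : μ * μ = c * μ - n := by
    rw [Complex.normSq_apply] at hn
    apply Complex.ext
    · simp only [Complex.mul_re, Complex.sub_re, Complex.intCast_re, Complex.intCast_im]
      rw [← hc, ← hn]; ring
    · simp only [Complex.mul_im, Complex.sub_im, Complex.intCast_re, Complex.intCast_im]
      rw [← hc]; ring
  induction hz using Subring.closure_induction with
  | mem x hx => exact ⟨0, 1, by simp_all⟩
  | zero => exact ⟨0, 0, by simp⟩
  | one => exact ⟨1, 0, by simp⟩
  | add x y _ _ hx hy =>
    obtain ⟨u, v, rfl⟩ := hx
    obtain ⟨u', v', rfl⟩ := hy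
    exact ⟨u + u', v + v', by push_cast; ring⟩
  | neg x _ hx =>
    obtain ⟨u, v, rfl⟩ := hx
    exact ⟨-u, -v, by push_cast; ring⟩
  | mul x y _ _ hx hy =>
    obtain ⟨u, v, rfl⟩ := hx
    obtain ⟨u', v', rfl⟩ := hy
    refine ⟨u * u' - v * v' * n, u * v' + v * u' + v * v' * c, ?_⟩
    push_cast
    linear_combination (v * v' : ℂ) * hμ

theorem one_le_norm_of_mem_closure_singleton {μ : ℂ} {c n : ℤ} (hc : 2 * μ.re = c)
    (hn : Complex.normSq μ = n) {z : ℂ} (hz : z ∈ Subring.closure {μ}) (h0 : z ≠ 0) :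
    1 ≤ ‖z‖ := by
  obtain ⟨u, v, rfl⟩ := exists_int_of_mem_closure_singleton hc hn hz
  have h1 : Complex.normSq (u + v * μ) = ((u * u + u * v * c + v * v * n : ℤ) : ℝ) := by
    push_cast
    rw [← hc, ← hn, Complex.normSq_apply, Complex.normSq_apply]
    simp
    ring
  have h2 := Complex.normSq_pos.2 h0
  rw [h1] at h2
  have h3 : (1 : ℝ) ≤ Complex.normSq (u + v * μ) := by
    rw [h1]
    exact_mod_cast h2
  rw [Complex.normSq_eq_norm_sq] at h3
  nlinarith [norm_nonneg (u + v * μ)]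

theorem mul_zpow_mem_closure_singleton {X c : ℤ} {ω : ℂ} (hω : ‖ω‖ = 1)
    (hc : 2 * (X * ω).re = c) {E : ℕ} {n : ℤ} (hn : n.natAbs ≤ E) :
    (X : ℂ) ^ E * ω ^ n ∈ Subring.closure {(X : ℂ) * ω} := by
  have hμ : (X : ℂ) * ω ∈ Subring.closure {(X : ℂ) * ω} := Subring.subset_closure rfl
  have hinv : (X : ℂ) * ω⁻¹ ∈ Subring.closure {(X : ℂ) * ω} := by
    have h : (X : ℂ) * ω⁻¹ = c - X * ω := by
      rw [Complex.inv_eq_conj hω]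
      have h1 : ((2 * (X * ω).re : ℝ) : ℂ) = (X : ℂ) * ω + (starRingEnd ℂ) ((X : ℂ) * ω) := by
        rw [Complex.add_conj]
      rw [hc] at h1
      simp only [map_mul, map_intCast, Complex.ofReal_intCast] at h1
      rw [h1]; ring
    rw [h]
    exact sub_mem (intCast_mem _ _) hμ
  obtain ⟨m, rfl⟩ := Nat.exists_eq_add_of_le hn
  obtain h | h := Int.natAbs_eq n
  · have : (X : ℂ) ^ (n.natAbs + m) * ω ^ n = X ^ m * (X * ω) ^ n.natAbs := by
      nth_rw 2 [h]
      rw [zpow_natCast]; ring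
    rw [this]
    exact mul_mem (pow_mem (intCast_mem _ _) _) (pow_mem hμ _)
  · have : (X : ℂ) ^ (n.natAbs + m) * ω ^ n = X ^ m * (X * ω⁻¹) ^ n.natAbs := by
      nth_rw 2 [h]
      rw [_root_.zpow_neg, zpow_natCast, mul_pow, inv_pow]; ring
    rw [this]
    exact mul_mem (pow_mem (intCast_mem _ _) _) (pow_mem hinv _)

theorem Matrix.prod_mul_det_mem {ι R : Type*} [Fintype ι] [DecidableEq ι] [CommRing R]
    (S : Subring R) (M : Matrix ι ι R) (w : ι → R) (h : ∀ i j, w j * M i j ∈ S) :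
    (∏ j, w j) * M.det ∈ S := by
  have h1 : (∏ j, w j) * M.det = (M * diagonal w).det := by
    rw [det_mul, det_diagonal, mul_comm]
  have h2 : M * diagonal w =
      S.subtype.mapMatrix (of fun i j => (⟨w j * M i j, h i j⟩ : S)) := by
    ext i j
    simp [mul_diagonal, mul_comm]
  rw [h1, h2, ← RingHom.map_det]
  exact Subtype.property _
end

section
open Matrix Polynomial Complex

/-- The value at `a = r b + s ℓ` of the binomial polynomial of degree `k`, times the `j`-th power
of `exp (i (r ψ + s π))`. -/
noncomputable def interpolationEntry (b ℓ : ℕ) (ψ : ℝ) (r s : ℤ) (k : ℕ) (j : ℤ) : ℂ :=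
  (binomialPolynomial k).eval ((r * b + s * ℓ : ℤ) : ℂ) *
    exp (j * (((r * ψ + s * Real.pi : ℝ) : ℂ) * I))

theorem pow_mul_interpolationEntry_mem {b ℓ : ℕ} {ψ : ℝ} {X c : ℤ} (hc : 2 * X * Real.cos ψ = c)
    {r s j : ℤ} (k : ℕ) {E : ℕ} (hE : (r * j).natAbs ≤ E) :
    (X : ℂ) ^ E * interpolationEntry b ℓ ψ r s k j ∈
      Subring.closure {(X : ℂ) * exp (ψ * I)} := by
  obtain ⟨n, hn⟩ := exists_int_eval_binomialPolynomial k (r * b + s * ℓ)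
  obtain ⟨ε, hε⟩ : ∃ ε : ℤ, (-1 : ℂ) ^ (s * j) = ε := by
    obtain h | h := Int.even_or_odd (s * j)
    · exact ⟨1, by rw [h.neg_one_zpow]; simp⟩
    · exact ⟨-1, by rw [h.neg_one_zpow]; simp⟩
  have h1 : exp (j * (((r * ψ + s * Real.pi : ℝ) : ℂ) * I)) = exp (ψ * I) ^ (r * j) * ε := by
    rw [← hε, ← exp_pi_mul_I, ← exp_int_mul, ← exp_int_mul, ← exp_add]
    congr 1
    push_cast
    ring
  rw [interpolationEntry, hn, h1]
  have h2 := mul_zpow_mem_closure_singleton (X := X) (c := c) (ω := exp (ψ * I))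
    (norm_exp_ofReal_mul_I ψ) (by
      have : (X : ℂ) = ((X : ℝ) : ℂ) := by simp
      rw [this, re_ofReal_mul, exp_ofReal_mul_I_re, ← hc]; ring) hE
  have h3 : (X : ℂ) ^ E * (n * (exp (ψ * I) ^ (r * j) * ε)) =
      (n * ε : ℤ) * ((X : ℂ) ^ E * exp (ψ * I) ^ (r * j)) := by
    push_cast
    ring
  rw [h3]
  exact mul_mem (intCast_mem _ _) h2

theorem exists_interpolationEntry_det_ne_zero {b ℓ R S K h : ℕ} {ψ : ℝ}
    (hcop : b.Coprime ℓ) (hR : 2 * R + 1 ≤ ℓ) (hRh : h ≤ R)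
    (hψ : Function.Injective fun l : Fin (2 * h + 1) => exp (ψ * I) ^ (l : ℕ))
    (hRS : (2 * h + 1) * (K - 1) < (2 * R + 1 - 2 * h) * (2 * S + 1)) :
    ∃ r s : Fin K × Fin (2 * h + 1) → ℤ, (∀ i, |r i| ≤ R) ∧ (∀ i, |s i| ≤ S) ∧
      (Function.Injective fun i => r i * b + s i * ℓ) ∧
      (of fun i c : Fin K × Fin (2 * h + 1) =>
        interpolationEntry b ℓ ψ (r i) (s i) c.1 ((c.2 : ℤ) - h)).det ≠ 0 := by
  have hinj : ∀ r s r' s' : ℤ, |r| ≤ R → |r'| ≤ R → r * b + s * ℓ = r' * b + s' * ℓ →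
      r = r' ∧ s = s' := by
    intro r s r' s' hr hr' he
    have h1 : (ℓ : ℤ) ∣ (r - r') * b := ⟨s' - s, by linear_combination he⟩
    have h2 : (ℓ : ℤ) ∣ r - r' :=
      IsCoprime.dvd_of_dvd_mul_right (Nat.isCoprime_iff_coprime.2 hcop.symm) h1
    have h3 : r - r' = 0 := by
      refine Int.eq_zero_of_abs_lt_dvd h2 ?_
      rw [abs_le] at hr hr'
      rw [abs_lt]
      omega
    have h4 : r = r' := by omega
    subst h4
    refine ⟨rfl, ?_⟩
    have : (ℓ : ℤ) ≠ 0 := by omega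
    exact mul_right_cancel₀ this (by linarith)
  let A : Matrix (Fin (2 * R + 1) × Fin (2 * S + 1)) (Fin K × Fin (2 * h + 1)) ℂ :=
    of fun p c => interpolationEntry b ℓ ψ ((p.1 : ℤ) - R) ((p.2 : ℤ) - S) c.1 ((c.2 : ℤ) - h)
  obtain ⟨f, hf⟩ := exists_submatrix_det_ne_zero A (by
    intro v hv
    let x : ℕ → ℕ → ℂ := fun r s => ((((r : ℤ) - R) * b + ((s : ℤ) - S) * ℓ : ℤ) : ℂ)
    let y : ℕ → ℕ → ℂ := fun r s =>
      exp ((((((r : ℤ) - R : ℤ) : ℝ) * ψ + (((s : ℤ) - S : ℤ) : ℝ) * Real.pi : ℝ) : ℂ) * I)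
    have hP := eq_zero_of_sum_eval_mul_pow_eq_zero (L := 2 * h + 1) (R := 2 * R + 1 - 2 * h)
      (S := 2 * S + 1) (K := K - 1) (ω := exp (ψ * I)) (b := b) (x := x) (y := y)
      (fun l => ∑ k : Fin K, C (v (k, l)) * binomialPolynomial k)
      (fun l => natDegree_sum_binomialPolynomial_le _) hψ (fun _ _ => exp_ne_zero _)
      (fun r s u => by simp only [x]; push_cast; ring)
      (fun r s u => by
        simp only [y]
        rw [← exp_nat_mul, ← exp_add]
        congr 1
        push_cast
        ring)
      (by
        rintro ⟨r, s⟩ ⟨r', s'⟩ he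
        have he' : ((r : ℤ) - R) * b + ((s : ℤ) - S) * ℓ =
          ((r' : ℤ) - R) * b + ((s' : ℤ) - S) * ℓ := Int.cast_injective (α := ℂ) he
        have := hinj _ _ _ _ (by rw [abs_le]; omega) (by rw [abs_le]; omega) he'
        ext <;> simp <;> omega)
      hRS
      (by
        intro r s hr hs
        have h1 := congrFun hv (⟨r, by omega⟩, ⟨s, hs⟩)
        simp only [mulVec, dotProduct, Fintype.sum_prod_type, A, of_apply, interpolationEntry,
          Pi.zero_apply] at h1
        rw [Finset.sum_comm] at h1
        have h2 := congrArg (fun z => y r s ^ h * z) h1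
        simp only [mul_zero, Finset.mul_sum] at h2
        rw [← h2]
        refine Finset.sum_congr rfl fun l _ => ?_
        rw [eval_finsetSum, Finset.sum_mul]
        refine Finset.sum_congr rfl fun k _ => ?_
        rw [eval_mul, eval_C]
        have h3 : exp ((((l : ℤ) - h : ℤ) : ℂ) * ((((((r : ℤ) - R : ℤ) : ℝ) * ψ +
            (((s : ℤ) - S : ℤ) : ℝ) * Real.pi : ℝ) : ℂ) * I)) * y r s ^ h = y r s ^ (l : ℕ) := by
          simp only [y]
          rw [← exp_nat_mul, ← exp_nat_mul, ← exp_add]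
          congr 1
          push_cast
          ring
        rw [← h3]
        simp only [x]
        ring)
    ext ⟨k, l⟩
    have h1 := eq_zero_of_sum_binomialPolynomial_eq_zero (congrFun hP l)
    exact congrFun h1 k)
  refine ⟨fun i => ((f i).1 : ℤ) - R, fun i => ((f i).2 : ℤ) - S, fun i => ?_, fun i => ?_, ?_, hf⟩
  · have := (f i).1.2
    simp only [abs_le]
    omega
  · have := (f i).2.2
    simp only [abs_le]
    omega
  · intro i j hij
    have h1 := hinj (((f i).1 : ℤ) - R) (((f i).2 : ℤ) - S) (((f j).1 : ℤ) - R) (((f j).2 : ℤ) - S)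
      (by rw [abs_le]; omega) (by rw [abs_le]; omega) hij
    by_contra hne
    refine hf (det_zero_of_row_eq hne ?_)
    have h2 : f i = f j := Prod.ext (Fin.ext (by omega)) (Fin.ext (by omega))
    ext c
    simp [h2]

theorem norm_det_interpolation_le_of_fintype {ι : Type*} [Fintype ι] [DecidableEq ι] {a : ι → ℂ}
    (ha : Function.Injective a) {f : ι → ℂ → ℂ} (hf : ∀ c, Differentiable ℂ (f c))
    (B : Matrix ι ι ℂ) {ρ : ℝ} (hρ : 1 ≤ ρ) {C : ι → ℝ}
    (hC : ∀ i c z, ‖z‖ = ρ → ‖f c (z * a i)‖ + ρ ^ Fintype.card ι * ‖B i c‖ ≤ C c) :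
    ‖(of fun i c => f c (a i) + B i c).det‖ * ρ ^ (∑ i ∈ Finset.range (Fintype.card ι), i) ≤
      (Fintype.card ι).factorial * ∏ c, C c := by
  let e := Fintype.equivFin ι
  have h := norm_det_interpolation_le (ha.comp e.symm.injective) (fun c => hf (e.symm c))
    (B.submatrix e.symm e.symm) hρ (C := C ∘ e.symm) fun i c z hz => hC _ _ z hz
  rw [Finset.sum_range]
  rw [← det_submatrix_equiv_self e.symm, ← Equiv.prod_comp e.symm C]
  exact h

theorem norm_interpolationEntry_approx {b ℓ R S K h : ℕ} {ψ δ ρ : ℝ} (hℓ : 0 < ℓ) (hρ : 1 ≤ ρ)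
    (hψ : ψ = Real.pi * b / ℓ + δ) {N : ℕ} (hδ : h * R * |δ| * ρ ^ N ≤ 1) {r s j : ℤ} {k : ℕ}
    (hr : |r| ≤ R) (hs : |s| ≤ S) (hj : |j| ≤ h) (hk : k ≤ K) {z : ℂ} (hz : ‖z‖ = ρ) :
    ‖(binomialPolynomial k).eval (z * (r * b + s * ℓ : ℤ)) *
        exp (j * (Real.pi / ℓ * (z * (r * b + s * ℓ : ℤ)) * I))‖ +
      ρ ^ N * ‖interpolationEntry b ℓ ψ r s k j - (binomialPolynomial k).eval
        ((r * b + s * ℓ : ℤ) : ℂ) * exp (j * (Real.pi / ℓ * ((r * b + s * ℓ : ℤ) : ℂ) * I))‖ ≤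
      2 * ((ρ * (R * b + S * ℓ) + K) ^ k / k.factorial *
        Real.exp (|j| * (Real.pi / ℓ * (ρ * (R * b + S * ℓ))))) := by
  set a : ℤ := r * b + s * ℓ with ha
  set A : ℝ := R * b + S * ℓ with hA
  have hr' : |(r : ℝ)| ≤ R := by exact_mod_cast hr
  have hs' : |(s : ℝ)| ≤ S := by exact_mod_cast hs
  have hj' : |(j : ℝ)| ≤ h := by exact_mod_cast hj
  have hk' : (k : ℝ) ≤ K := by exact_mod_cast hk
  have hℓ' : (0 : ℝ) < ℓ := by exact_mod_cast hℓ
  have haA : ‖(a : ℂ)‖ ≤ A := by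
    rw [norm_intCast, ha, hA]
    push_cast
    refine (abs_add_le _ _).trans ?_
    rw [abs_mul, abs_mul, Nat.abs_cast, Nat.abs_cast]
    gcongr
  have hA0 : 0 ≤ A := (norm_nonneg _).trans haA
  have hbin : ∀ w : ℂ, ‖w‖ ≤ ρ * A →
      ‖(binomialPolynomial k).eval w‖ ≤ (ρ * A + K) ^ k / k.factorial := fun w hw =>
    (norm_eval_binomialPolynomial_le k w).trans (by gcongr)
  have hza : ‖z * a‖ ≤ ρ * A := by
    rw [norm_mul, hz]
    gcongr
  have h1 : ‖exp (j * (Real.pi / ℓ * (z * a) * I))‖ ≤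
      Real.exp (|j| * (Real.pi / ℓ * (ρ * A))) := by
    rw [norm_exp]
    refine Real.exp_le_exp.2 ((re_le_norm _).trans ?_)
    rw [norm_mul, norm_mul, norm_mul, norm_I, mul_one, norm_intCast, norm_div, norm_real,
      Real.norm_of_nonneg Real.pi_pos.le, norm_natCast]
    push_cast
    gcongr
  have h2 : interpolationEntry b ℓ ψ r s k j - (binomialPolynomial k).eval (a : ℂ) *
      exp (j * (Real.pi / ℓ * (a : ℂ) * I)) = (binomialPolynomial k).eval (a : ℂ) *
        (exp (((j * (Real.pi / ℓ * a) : ℝ) : ℂ) * I) * (exp (I * ((j * r * δ : ℝ) : ℂ)) - 1)) := by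
    rw [mul_sub, mul_one, ← exp_add, mul_sub, interpolationEntry, ← ha]
    congr 3
    · rw [hψ, ha]
      have : (ℓ : ℂ) ≠ 0 := by exact_mod_cast hℓ.ne'
      push_cast
      field_simp
      ring
    · push_cast
      ring
  have h3 : ‖interpolationEntry b ℓ ψ r s k j - (binomialPolynomial k).eval (a : ℂ) *
      exp (j * (Real.pi / ℓ * (a : ℂ) * I))‖ ≤
        (ρ * A + K) ^ k / k.factorial * (h * R * |δ|) := by
    rw [h2, norm_mul, norm_mul, norm_exp_ofReal_mul_I, one_mul]
    gcongr
    · exact hbin _ (haA.trans (le_mul_of_one_le_left hA0 hρ))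
    · refine (Real.norm_exp_I_mul_ofReal_sub_one_le).trans ?_
      rw [Real.norm_eq_abs, abs_mul, abs_mul]
      gcongr
  have hQ : 0 ≤ (ρ * A + K) ^ k / k.factorial := by positivity
  have hE : 1 ≤ Real.exp (|j| * (Real.pi / ℓ * (ρ * A))) := Real.one_le_exp (by positivity)
  rw [norm_mul, two_mul]
  refine add_le_add (mul_le_mul (hbin _ hza) h1 (norm_nonneg _) hQ) ?_
  calc _ ≤ ρ ^ N * ((ρ * A + K) ^ k / k.factorial * (h * R * |δ|)) := by gcongr
    _ = (ρ * A + K) ^ k / k.factorial * (h * R * |δ| * ρ ^ N) := by ring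
    _ ≤ (ρ * A + K) ^ k / k.factorial * 1 := by gcongr
    _ ≤ _ := by gcongr

/-- The inequality obtained by comparing the arithmetic lower bound and the analytic upper bound
for an interpolation determinant attached to `exp (i ψ)`, where `ψ` is close to `π b / ℓ`. -/
theorem interpolation_inequality {b ℓ R S K h : ℕ} {ψ δ ρ : ℝ} {X c : ℤ} (hX : 0 < X)
    (hc : 2 * X * Real.cos ψ = c)
    (hcop : b.Coprime ℓ) (hR : 2 * R + 1 ≤ ℓ) (hRh : h ≤ R)
    (hinj : Function.Injective fun l : Fin (2 * h + 1) => exp (ψ * I) ^ (l : ℕ))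
    (hRS : (2 * h + 1) * (K - 1) < (2 * R + 1 - 2 * h) * (2 * S + 1)) (hρ : 1 ≤ ρ)
    (hψ : ψ = Real.pi * b / ℓ + δ) (hδ : h * R * |δ| * ρ ^ (K * (2 * h + 1)) ≤ 1) :
    ρ ^ (∑ i ∈ Finset.range (K * (2 * h + 1)), i) ≤
      (X : ℝ) ^ (∑ q : Fin K × Fin (2 * h + 1), R * ((q.2 : ℤ) - h).natAbs) *
        ((K * (2 * h + 1)).factorial * ∏ q : Fin K × Fin (2 * h + 1),
          (2 * ((ρ * (R * b + S * ℓ) + K) ^ (q.1 : ℕ) / (q.1 : ℕ).factorial *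
            Real.exp (|(q.2 : ℤ) - (h : ℤ)| * (Real.pi / ℓ * (ρ * (R * b + S * ℓ))))))) := by
  have hℓ : 0 < ℓ := by omega
  obtain ⟨r, s, hr, hs, hrs, hdet⟩ :=
    exists_interpolationEntry_det_ne_zero hcop hR hRh hinj hRS
  set M : Matrix (Fin K × Fin (2 * h + 1)) (Fin K × Fin (2 * h + 1)) ℂ := of fun i c =>
    interpolationEntry b ℓ ψ (r i) (s i) c.1 ((c.2 : ℤ) - h) with hM
  have hlow : 1 ≤ (X : ℝ) ^ (∑ q : Fin K × Fin (2 * h + 1), R * ((q.2 : ℤ) - h).natAbs) *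
      ‖M.det‖ := by
    have h1 := prod_mul_det_mem (Subring.closure {(X : ℂ) * exp (ψ * I)}) M
      (fun q => (X : ℂ) ^ (R * ((q.2 : ℤ) - h).natAbs)) fun i q =>
        pow_mul_interpolationEntry_mem hc _ (by
          rw [Int.natAbs_mul]
          have := hr i
          rw [Int.abs_eq_natAbs] at this
          gcongr
          omega)
    rw [Finset.prod_pow_eq_pow_sum] at h1
    have hXC : ((X : ℝ) : ℂ) = X := by simp
    have h2 := one_le_norm_of_mem_closure_singleton (c := c) (n := X ^ 2)
      (by rw [← hXC, re_ofReal_mul, exp_ofReal_mul_I_re, ← hc]; ring)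
      (by rw [normSq_eq_norm_sq, norm_mul, norm_exp_ofReal_mul_I, norm_intCast]; simp) h1
      (mul_ne_zero (pow_ne_zero _ (by exact_mod_cast hX.ne')) hdet)
    rwa [norm_mul, norm_pow, norm_intCast, abs_of_pos (by exact_mod_cast hX)] at h2
  have hcard : Fintype.card (Fin K × Fin (2 * h + 1)) = K * (2 * h + 1) := by simp
  have hup := norm_det_interpolation_le_of_fintype
    (a := fun i => ((r i * b + s i * ℓ : ℤ) : ℂ)) (Int.cast_injective.comp hrs)
    (f := fun (q : Fin K × Fin (2 * h + 1)) z => (binomialPolynomial q.1).eval z *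
      exp (((((q.2 : ℤ) - h : ℤ)) : ℂ) * (Real.pi / ℓ * z * I)))
    (fun q => by fun_prop)
    (of fun i q => interpolationEntry b ℓ ψ (r i) (s i) q.1 ((q.2 : ℤ) - h) -
      (binomialPolynomial q.1).eval ((r i * b + s i * ℓ : ℤ) : ℂ) *
        exp ((((q.2 : ℤ) - h : ℤ) : ℂ) * (Real.pi / ℓ * ((r i * b + s i * ℓ : ℤ) : ℂ) * I)))
    hρ (fun i q z hz => norm_interpolationEntry_approx hℓ hρ hψ (hcard ▸ hδ) (hr i) (hs i)
      (by rw [abs_le]; omega) q.1.2.le hz)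
  simp only [of_apply, add_sub_cancel, hcard] at hup
  rw [← hM] at hup
  have hX' : (0 : ℝ) < X := by exact_mod_cast hX
  calc _ ≤ (X : ℝ) ^ (∑ q : Fin K × Fin (2 * h + 1), R * ((q.2 : ℤ) - h).natAbs) *
      ‖M.det‖ * ρ ^ (∑ i ∈ Finset.range (K * (2 * h + 1)), i) :=
        le_mul_of_one_le_left (by positivity) hlow
    _ ≤ _ := by
      rw [mul_assoc]
      gcongr
end

section
open Complex

theorem injective_exp_mul_I_pow {b ℓ n : ℕ} {ψ δ : ℝ} (hℓ : n ≤ ℓ) (hcop : b.Coprime ℓ)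
    (hψ : ψ = Real.pi * b / ℓ + δ) (hδ : n * ℓ * |δ| < Real.pi) :
    Function.Injective fun l : Fin n => exp (ψ * I) ^ (l : ℕ) := by
  refine .of_lt_imp_ne fun i j hij he => ?_
  have hℓ0 : 0 < ℓ := i.pos.trans_le hℓ
  obtain ⟨d, hd⟩ := Nat.exists_eq_add_of_lt (show (i : ℕ) < j from hij)
  have h1 : exp (ψ * I) ^ (d + 1) = 1 := by
    have h2 : exp (ψ * I) ^ (i : ℕ) * exp (ψ * I) ^ (d + 1) = exp (ψ * I) ^ (i : ℕ) * 1 := by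
      rw [← pow_add, mul_one, he, hd, add_assoc]
    exact mul_left_cancel₀ (pow_ne_zero _ (exp_ne_zero _)) h2
  rw [← exp_nat_mul, exp_eq_one_iff] at h1
  obtain ⟨k, hk⟩ := h1
  have hk' : (d + 1) * ψ = k * (2 * Real.pi) := by
    have h3 : (((d + 1) * ψ : ℝ) : ℂ) * I = ((k * (2 * Real.pi) : ℝ) : ℂ) * I := by
      push_cast
      push_cast at hk
      linear_combination hk
    exact_mod_cast mul_right_cancel₀ I_ne_zero h3
  have hℓ' : (0 : ℝ) < ℓ := by exact_mod_cast hℓ0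
  have h4 : (((d + 1) * b - 2 * k * ℓ : ℤ) : ℝ) * Real.pi = -((d + 1) * ℓ * δ) := by
    rw [hψ] at hk'
    field_simp at hk'
    push_cast
    linear_combination hk'
  have h5 : ((d + 1) * b - 2 * k * ℓ : ℤ) ≠ 0 := by
    intro h0
    have h6 : (ℓ : ℤ) ∣ ((d + 1 : ℕ) : ℤ) * b := ⟨2 * k, by push_cast; linear_combination h0⟩
    have h7 : ℓ ∣ d + 1 := hcop.symm.dvd_of_dvd_mul_right (by exact_mod_cast h6)
    have := Nat.le_of_dvd d.succ_pos h7
    have := j.2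
    omega
  have h8 : (1 : ℝ) ≤ |(((d + 1) * b - 2 * k * ℓ : ℤ) : ℝ)| := by
    exact_mod_cast Int.one_le_abs h5
  have h9 := congrArg abs h4
  rw [abs_mul, abs_of_pos Real.pi_pos, abs_neg, abs_mul,
    abs_of_nonneg (show (0 : ℝ) ≤ (d + 1) * ℓ by positivity)] at h9
  have h10 : ((d + 1 : ℕ) : ℝ) ≤ n := by
    exact_mod_cast (by have := j.2; omega)
  push_cast at h10
  have h11 : (d + 1) * ℓ * |δ| ≤ n * ℓ * |δ| := by gcongr
  nlinarith [Real.pi_pos]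

theorem not_exists_close_rational_angle {b ℓ e : ℕ} {X c : ℤ} {ψ δ : ℝ} (he : 17 ≤ e)
    (hX : (2 : ℤ) ^ e ≤ X) (hX' : X < 2 ^ (e + 1)) (hℓ : 43867 ≤ ℓ) (hℓ' : ℓ ≤ 657931)
    (hb : 2 * b ≤ ℓ) (hcop : b.Coprime ℓ) (hc : 2 * X * Real.cos ψ = c)
    (hψ : ψ = Real.pi * b / ℓ + δ) : Real.pi < |δ| * 2 ^ (21933 * e) := by
  by_contra! hδ
  have hπ := Real.pi_gt_three
  have hπ' := Real.pi_lt_d2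
  have he' : (17 : ℝ) ≤ e := by exact_mod_cast he
  have hℓR : (ℓ : ℝ) ≤ 657931 := by exact_mod_cast hℓ'
  have hℓ0 : (0 : ℝ) < ℓ := by exact_mod_cast (by omega : 0 < ℓ)
  have hbR : 2 * (b : ℝ) ≤ ℓ := by exact_mod_cast hb
  have hX0 : 0 < X := lt_of_lt_of_le (by positivity) hX
  have h7 : (7 : ℕ) * (130 : ℕ) * |δ| * 8 ^ (300 * e * (2 * 7 + 1)) ≤ 1 := by
    have h1 : (2 : ℝ) ^ 12 * 8 ^ (300 * e * (2 * 7 + 1)) ≤ 2 ^ (21933 * e) := by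
      rw [show (8 : ℝ) = 2 ^ 3 by norm_num, ← pow_mul, ← pow_add]
      exact pow_le_pow_right₀ one_le_two (by omega)
    have h2 : |δ| * ((2 : ℝ) ^ 12 * 8 ^ (300 * e * (2 * 7 + 1))) ≤ 3.15 :=
      (mul_le_mul_of_nonneg_left h1 (abs_nonneg δ)).trans (hδ.trans hπ'.le)
    push_cast
    linarith
  have hinj : Function.Injective fun l : Fin (2 * 7 + 1) => exp (ψ * I) ^ (l : ℕ) := by
    refine injective_exp_mul_I_pow (by omega) hcop hψ ?_
    have h1 : (2 : ℝ) ^ 24 ≤ 2 ^ (21933 * e) := pow_le_pow_right₀ one_le_two (by omega)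
    have h2 : |δ| * (2 : ℝ) ^ 24 ≤ 3.15 :=
      (mul_le_mul_of_nonneg_left h1 (abs_nonneg δ)).trans (hδ.trans hπ'.le)
    have h3 : |δ| * ℓ ≤ |δ| * 657931 := by gcongr
    push_cast
    linarith
  have hmain := interpolation_inequality (R := 130) (S := 10 * e) (K := 300 * e) (h := 7)
    (ρ := 8) hX0 hc hcop (by omega) (by omega) hinj (by omega) (by norm_num) hψ h7
  set L := Real.log 2 with hL
  have hL0 : 0 < L := Real.log_pos one_lt_two
  have hLlow : 0.693 < L := by linarith [Real.log_two_gt_d9]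
  have hexpL : ∀ n : ℕ, Real.exp (n * L) = 2 ^ n := fun n => by
    rw [Real.exp_nat_mul, hL, Real.exp_log two_pos]
  set E : ℝ := 8 * Real.pi * (65 + 10 * e) with hE
  have hA : (130 : ℕ) * (b : ℝ) + (10 * e : ℕ) * ℓ ≤ ℓ * (65 + 10 * e) := by
    push_cast
    linarith
  have hP : 8 * ((130 : ℕ) * (b : ℝ) + (10 * e : ℕ) * ℓ) + (300 * e : ℕ) ≤
      2 ^ 18 * (300 * e : ℕ) := by
    have h1 : ℓ * (65 + 10 * (e : ℝ)) ≤ 657931 * (65 + 10 * e) := by gcongr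
    push_cast at hA ⊢
    linarith
  have hfac : ∀ q : Fin (300 * e) × Fin (2 * 7 + 1),
      2 * ((8 * ((130 : ℕ) * (b : ℝ) + (10 * e : ℕ) * ℓ) + (300 * e : ℕ)) ^ (q.1 : ℕ) /
        (q.1 : ℕ).factorial * Real.exp (|(q.2 : ℤ) - (7 : ℕ)| *
          (Real.pi / ℓ * (8 * ((130 : ℕ) * (b : ℝ) + (10 * e : ℕ) * ℓ))))) ≤
        Real.exp (L + 18 * L * (q.1 : ℕ) + (300 * e : ℕ) + |(q.2 : ℤ) - 7| * E) := by
    intro q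
    have h0 : Real.exp (L + 18 * L * (q.1 : ℕ) + (300 * e : ℕ) + |(q.2 : ℤ) - 7| * E) =
        2 * (Real.exp (18 * L * (q.1 : ℕ)) * Real.exp (300 * e : ℕ) *
          Real.exp (|(q.2 : ℤ) - 7| * E)) := by
      rw [Real.exp_add, Real.exp_add, Real.exp_add, hL, Real.exp_log two_pos]
      ring
    rw [h0]
    gcongr 2 * ?_
    refine mul_le_mul ?_ (Real.exp_le_exp.2 ?_) (Real.exp_pos _).le (by positivity)
    · calc _ ≤ (2 ^ 18 * ((300 * e : ℕ) : ℝ)) ^ (q.1 : ℕ) / (q.1 : ℕ).factorial := by gcongr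
        _ = (2 ^ 18) ^ (q.1 : ℕ) * (((300 * e : ℕ) : ℝ) ^ (q.1 : ℕ) / (q.1 : ℕ).factorial) := by
          rw [mul_pow, mul_div_assoc]
        _ ≤ (2 ^ 18) ^ (q.1 : ℕ) * Real.exp (300 * e : ℕ) := by
          gcongr
          exact Real.pow_div_factorial_le_exp _ (by positivity) _
        _ = _ := by
          rw [← pow_mul, ← hexpL]
          push_cast
          ring_nf
    · push_cast
      gcongr
      have h1 : Real.pi / ℓ * (8 * ((130 : ℕ) * (b : ℝ) + (10 * e : ℕ) * ℓ)) ≤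
          Real.pi / ℓ * (8 * (ℓ * (65 + 10 * e))) := by gcongr
      have h2 : Real.pi / ℓ * (8 * (ℓ * (65 + 10 * e))) = E := by
        rw [hE]; field_simp
      push_cast at h1
      linarith
  have hprod := Finset.prod_le_prod (s := Finset.univ)
    (fun (q : Fin (300 * e) × Fin (2 * 7 + 1)) _ => by positivity) fun q _ => hfac q
  rw [← Real.exp_sum] at hprod
  have hsumk : ∀ n : ℕ, ∑ k : Fin n, ((k : ℕ) : ℝ) = n * (n - 1) / 2 := fun n => by
    rw [Fin.sum_univ_eq_sum_range (fun k => (k : ℝ)) n]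
    induction n with
    | zero => simp
    | succ n ih => rw [Finset.sum_range_succ, ih]; push_cast; ring
  have hsum : ∑ q : Fin (300 * e) × Fin (2 * 7 + 1),
      (L + 18 * L * (q.1 : ℕ) + (300 * e : ℕ) + |(q.2 : ℤ) - 7| * E) =
        4500 * e * (L + 9 * L * (300 * e - 1) + 300 * e) + 300 * e * (56 * E) := by
    rw [Fintype.sum_prod_type_right]
    simp only [Finset.sum_add_distrib, ← Finset.mul_sum, hsumk, Finset.sum_const,
      Finset.card_univ, Fintype.card_fin, nsmul_eq_mul, ← Finset.sum_mul]
    have : ∑ l : Fin (2 * 7 + 1), ((|((l : ℕ) : ℤ) - 7| : ℤ) : ℝ) = 56 := by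
      simp [Fin.sum_univ_succ]
      norm_num
    rw [this]
    push_cast
    ring
  have hW : ∑ q : Fin (300 * e) × Fin (2 * 7 + 1), 130 * ((q.2 : ℤ) - (7 : ℕ)).natAbs =
      2184000 * e := by
    have : ∑ l : Fin (2 * 7 + 1), 130 * ((l : ℤ) - (7 : ℕ)).natAbs = 7280 := by decide
    rw [Fintype.sum_prod_type]
    simp only [this, Finset.sum_const, Finset.card_univ, Fintype.card_fin, smul_eq_mul]
    ring
  have hXL : (X : ℝ) ^ (2184000 * e) ≤ Real.exp ((e + 1) * L * (2184000 * e)) := by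
    have h1 : (X : ℝ) ≤ 2 ^ (e + 1) := by exact_mod_cast hX'.le
    calc _ ≤ ((2 : ℝ) ^ (e + 1)) ^ (2184000 * e) := by gcongr
      _ = _ := by
        rw [← pow_mul, ← hexpL]
        push_cast
        ring_nf
  have hN : ((300 * e * (2 * 7 + 1)).factorial : ℝ) ≤ Real.exp (2 * e * L * (4500 * e)) := by
    have h1 : 300 * e * (2 * 7 + 1) ≤ 2 ^ (2 * e) := by
      have h2 : ∀ n : ℕ, 17 ≤ n → 4500 * n ≤ 2 ^ (2 * n) := fun n hn => by
        induction n, hn using Nat.le_induction with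
        | base => norm_num
        | succ n hn ih => rw [show 2 * (n + 1) = 2 * n + 2 by ring, pow_add]; omega
      have := h2 e he
      omega
    calc _ ≤ (((300 * e * (2 * 7 + 1)) ^ (300 * e * (2 * 7 + 1)) : ℕ) : ℝ) := by
          exact_mod_cast Nat.factorial_le_pow _
      _ ≤ (((2 ^ (2 * e)) ^ (300 * e * (2 * 7 + 1)) : ℕ) : ℝ) := by
          exact_mod_cast Nat.pow_le_pow_left h1 _
      _ = _ := by
        rw [← pow_mul, Nat.cast_pow, Nat.cast_ofNat, ← hexpL]
        push_cast
        ring_nf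
  have h8 : (8 : ℝ) ^ (∑ i ∈ Finset.range (300 * e * (2 * 7 + 1)), i) =
      Real.exp (3 * L * (4500 * e * (4500 * e - 1) / 2)) := by
    rw [show (8 : ℝ) = 2 ^ 3 by norm_num, ← pow_mul, ← hexpL, Nat.cast_mul,
      ← Fin.sum_univ_eq_sum_range (fun k => k), Nat.cast_sum, hsumk]
    push_cast
    ring_nf
  rw [hW, h8] at hmain
  have hfin := hmain.trans (mul_le_mul hXL (mul_le_mul hN hprod
    (Finset.prod_nonneg fun _ _ => by positivity) (Real.exp_pos _).le) (by positivity)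
    (Real.exp_pos _).le)
  rw [hsum, ← Real.exp_add, ← Real.exp_add, Real.exp_le_exp] at hfin
  have hE' : E ≤ 8 * 3.15 * (65 + 10 * e) := by rw [hE]; gcongr
  have h9 : 4500 * (e : ℝ) * (3 * L * (4500 * e - 1) / 2) ≤ 4500 * e *
      ((e + 1) * L * 2184000 / 4500 + 2 * e * L + (L + 9 * L * (300 * e - 1) + 300 * e) +
        300 / 4500 * (56 * E)) := by
    linarith
  have h10 := le_of_mul_le_mul_left h9 (by positivity)
  nlinarith
end

theorem map_ThueF {R S : Type*} [CommRing R] [CommRing S] (φ : R →+* S) (X Y : R) :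
    ∀ m, φ (ThueF X Y m) = ThueF (φ X) (φ Y) m
  | 0 => by simp [ThueF]
  | 1 => by simp [ThueF]
  | m + 2 => by simp [ThueF, map_ThueF φ X Y (m + 1), map_ThueF φ X Y m, map_ofNat]

theorem ThueF_mul_sin (X θ : ℝ) :
    ∀ m : ℕ, ThueF X (4 * X * Real.cos θ ^ 2) m * Real.sin θ =
      X ^ m * Real.sin ((2 * m + 1) * θ)
  | 0 => by simp [ThueF]
  | 1 => by
    have h : Real.sin ((2 * (1 : ℕ) + 1) * θ) = 3 * Real.sin θ - 4 * Real.sin θ ^ 3 := by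
      rw [← Real.sin_three_mul]
      norm_num
    rw [h, ThueF, Real.cos_sq']
    ring
  | m + 2 => by
    have h0 := ThueF_mul_sin X θ m
    have h1 := ThueF_mul_sin X θ (m + 1)
    have h2 : Real.sin ((2 * (m + 2 : ℕ) + 1) * θ) + Real.sin ((2 * m + 1) * θ) =
        2 * Real.sin ((2 * (m + 1 : ℕ) + 1) * θ) * Real.cos (2 * θ) := by
      have e1 : (2 * (m + 2 : ℕ) + 1) * θ = (2 * (m + 1 : ℕ) + 1) * θ + 2 * θ := by
        push_cast; ring
      have e2 : (2 * (m : ℝ) + 1) * θ = (2 * (m + 1 : ℕ) + 1) * θ - 2 * θ := by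
        push_cast; ring
      rw [e1, e2, Real.sin_add, Real.sin_sub]
      ring
    rw [Real.cos_two_mul] at h2
    rw [ThueF]
    linear_combination (4 * X * Real.cos θ ^ 2 - 2 * X) * h1 - X ^ 2 * h0 - X ^ (m + 2) * h2

theorem pow_le_ThueF {X Y : ℤ} (hX : 0 ≤ X) (hY : 4 * X ≤ Y) (m : ℕ) :
    X ^ m ≤ ThueF X Y m ∧ X * ThueF X Y m ≤ ThueF X Y (m + 1) := by
  induction m with
  | zero => simp only [ThueF, pow_zero]; omega
  | succ m ih =>
    obtain ⟨h1, h2⟩ := ih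
    have h3 : X ^ (m + 1) ≤ ThueF X Y (m + 1) := by
      rw [pow_succ']
      exact (mul_le_mul_of_nonneg_left h1 hX).trans h2
    refine ⟨h3, ?_⟩
    have h4 : 0 ≤ ThueF X Y (m + 1) := (pow_nonneg hX _).trans h3
    rw [ThueF]
    nlinarith [mul_le_mul_of_nonneg_left h2 hX, mul_nonneg h4 (sub_nonneg.2 hY)]

theorem pow_le_neg_one_pow_mul_ThueF {X Y : ℤ} (hX : 0 ≤ X) (hY : Y ≤ 0) (m : ℕ) :
    X ^ m ≤ (-1) ^ m * ThueF X Y m ∧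
      X * ((-1) ^ m * ThueF X Y m) ≤ (-1) ^ (m + 1) * ThueF X Y (m + 1) := by
  induction m with
  | zero => simp only [ThueF, pow_zero]; omega
  | succ m ih =>
    obtain ⟨h1, h2⟩ := ih
    have h3 : X ^ (m + 1) ≤ (-1) ^ (m + 1) * ThueF X Y (m + 1) := by
      rw [pow_succ']
      exact (mul_le_mul_of_nonneg_left h1 hX).trans h2
    refine ⟨h3, ?_⟩
    have h4 : 0 ≤ (-1) ^ (m + 1) * ThueF X Y (m + 1) := (pow_nonneg hX _).trans h3
    have h5 : (-1) ^ (m + 1 + 1) * ThueF X Y (m + 1 + 1) =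
        (2 * X - Y) * ((-1) ^ (m + 1) * ThueF X Y (m + 1)) -
          X ^ 2 * ((-1) ^ m * ThueF X Y m) := by
      rw [ThueF]
      ring
    rw [h5]
    nlinarith [mul_le_mul_of_nonneg_left h2 hX, mul_nonneg h4 (neg_nonneg.2 hY)]

theorem Real.exists_int_abs_sub_le_abs_sin (t : ℝ) :
    ∃ j : ℤ, |t - j * Real.pi| ≤ Real.pi / 2 * |Real.sin t| := by
  refine ⟨round (t / Real.pi), ?_⟩
  have h1 : |t - round (t / Real.pi) * Real.pi| ≤ Real.pi / 2 := by
    have h2 := abs_sub_round (t / Real.pi)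
    have h3 : t - round (t / Real.pi) * Real.pi = (t / Real.pi - round (t / Real.pi)) * Real.pi := by
      field_simp
    rw [h3, abs_mul, abs_of_pos Real.pi_pos]
    nlinarith [Real.pi_pos]
  have h4 := Real.mul_abs_le_abs_sin h1
  rw [Real.sin_sub_int_mul_pi, abs_mul, abs_zpow, abs_neg, abs_one, one_zpow, one_mul] at h4
  calc _ = Real.pi / 2 * (2 / Real.pi * |t - round (t / Real.pi) * Real.pi|) := by field_simp
    _ ≤ _ := by gcongr

theorem coprime_of_close_rational_angle {ℓ : ℕ} {b : ℤ} {ψ : ℝ} (hℓ : ℓ.Prime) (hb : b ≠ 0)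
    (h0 : 0 ≤ ψ) (h1 : ψ ≤ Real.pi / 2) (hδ : 2 * ℓ * |ψ - Real.pi * b / ℓ| < Real.pi) :
    ∃ n : ℕ, b = n ∧ 2 * n ≤ ℓ ∧ n.Coprime ℓ := by
  have hℓ0 : (0 : ℝ) < ℓ := by exact_mod_cast hℓ.pos
  have hπ := Real.pi_pos
  have h2 : |2 * ℓ * ψ - Real.pi * (2 * b)| < Real.pi := by
    have : 2 * ℓ * ψ - Real.pi * (2 * b) = 2 * ℓ * (ψ - Real.pi * b / ℓ) := by
      field_simp
    rwa [this, abs_mul, abs_of_pos (by positivity)]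
  rw [abs_lt] at h2
  have h3 : 2 * ℓ * ψ ≤ Real.pi * ℓ := by nlinarith
  have h4 : 0 ≤ 2 * ℓ * ψ := by positivity
  have h5 : (-1 : ℝ) < 2 * b := by nlinarith
  have h6 : (2 * b : ℝ) < ℓ + 1 := by nlinarith
  have h5' : -1 < 2 * b := by exact_mod_cast h5
  have h6' : 2 * b < ℓ + 1 := by exact_mod_cast h6
  lift b to ℕ using by omega
  have hℓ2 := hℓ.two_le
  exact ⟨b, rfl, by omega, (Nat.coprime_of_lt_prime (by omega) (by omega) hℓ).symm⟩

theorem exists_close_rational_angle {X Y : ℤ} {m : ℕ} (hX : 0 < X) (hm : (2 * m + 1).Prime)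
    (hXm : 2 * (2 * m + 1) < X ^ m) (h : |ThueF X Y m| = 2 * m + 1) :
    ∃ (b : ℕ) (c : ℤ) (ψ δ : ℝ), 2 * b ≤ 2 * m + 1 ∧ b.Coprime (2 * m + 1) ∧
      2 * X * Real.cos ψ = c ∧ ψ = Real.pi * b / (2 * m + 1 : ℕ) + δ ∧
      |δ| * X ^ m ≤ Real.pi := by
  have hY : 0 < Y := by
    by_contra! hY
    have h1 := (pow_le_neg_one_pow_mul_ThueF hX.le hY m).1
    have h2 := le_abs_self ((-1) ^ m * ThueF X Y m)
    rw [abs_mul, abs_pow, abs_neg, abs_one, one_pow, one_mul, h] at h2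
    omega
  have hY' : Y < 4 * X := by
    by_contra! hY'
    have h1 := (pow_le_ThueF hX.le hY' m).1
    have h2 := le_abs_self (ThueF X Y m)
    omega
  have hXR : (0 : ℝ) < X := by exact_mod_cast hX
  have hYR : (0 : ℝ) < Y := by exact_mod_cast hY
  have hYR' : (Y : ℝ) < 4 * X := by exact_mod_cast hY'
  obtain ⟨θ, hθ0, hθ1, hθ⟩ : ∃ θ : ℝ, 0 < θ ∧ θ < Real.pi / 2 ∧
      (Y : ℝ) = 4 * X * Real.cos θ ^ 2 := by
    refine ⟨Real.arccos (√(Y / (4 * X))), Real.arccos_pos.2 ?_, Real.arccos_lt_pi_div_two.2 ?_, ?_⟩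
    · rw [Real.sqrt_lt' one_pos, div_lt_iff₀ (by positivity)]
      linarith
    · positivity
    · rw [Real.cos_arccos (by linarith [Real.sqrt_nonneg (Y / (4 * X) : ℝ)]),
        Real.sq_sqrt (by positivity)]
      · field_simp
      · rw [Real.sqrt_le_one, div_le_one (by positivity)]
        exact hYR'.le
  have hsin : 0 < Real.sin θ := Real.sin_pos_of_pos_of_lt_pi hθ0 (by linarith)
  have hF : |ThueF (X : ℝ) (4 * X * Real.cos θ ^ 2) m| = 2 * m + 1 := by
    have h1 := map_ThueF (Int.castRingHom ℝ) X Y m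
    simp only [eq_intCast, hθ] at h1
    rw [← h1]
    exact_mod_cast h
  have hXmR : 2 * (2 * (m : ℝ) + 1) < X ^ m := by exact_mod_cast hXm
  have hXm0 : (0 : ℝ) < X ^ m := by positivity
  have hsinm : (2 * m + 1) * Real.sin θ = X ^ m * |Real.sin ((2 * m + 1) * θ)| := by
    have h1 := congrArg abs (ThueF_mul_sin X θ m)
    rwa [abs_mul, abs_mul, hF, abs_of_pos hsin, abs_of_pos hXm0] at h1
  obtain ⟨j, hj⟩ := Real.exists_int_abs_sub_le_abs_sin ((2 * m + 1) * θ)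
  have hπ := Real.pi_pos
  have hj1 : X ^ m * |(2 * m + 1) * θ - j * Real.pi| ≤
      Real.pi / 2 * ((2 * m + 1) * Real.sin θ) := by
    rw [hsinm]
    calc _ ≤ (X : ℝ) ^ m * (Real.pi / 2 * |Real.sin ((2 * m + 1) * θ)|) := by gcongr
      _ = _ := by ring
  have hj0 : j ≠ 0 := by
    rintro rfl
    rw [Int.cast_zero, zero_mul, sub_zero, abs_of_pos (by positivity)] at hj1
    have h1 := Real.sin_lt hθ0
    have h2 : Real.pi / 2 * ((2 * m + 1) * Real.sin θ) < 2 * ((2 * m + 1) * θ) := by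
      have h3 : Real.pi / 2 ≤ 2 := by linarith [Real.pi_le_four]
      calc _ ≤ 2 * ((2 * m + 1) * Real.sin θ) := by gcongr
        _ < _ := by gcongr
    nlinarith [mul_pos (show (0 : ℝ) < 2 * m + 1 by positivity) hθ0]
  have hδ : |2 * θ - 2 * Real.pi * j / (2 * m + 1 : ℕ)| * X ^ m ≤ Real.pi := by
    have h1 : 2 * θ - 2 * Real.pi * j / (2 * m + 1 : ℕ) =
        2 / (2 * m + 1) * ((2 * m + 1) * θ - j * Real.pi) := by
      push_cast
      field_simp
    rw [h1, abs_mul, abs_of_pos (by positivity)]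
    calc _ = 2 / (2 * (m : ℝ) + 1) * (X ^ m * |(2 * m + 1) * θ - j * Real.pi|) := by ring
      _ ≤ 2 / (2 * (m : ℝ) + 1) * (Real.pi / 2 * ((2 * m + 1) * 1)) := by
        refine mul_le_mul_of_nonneg_left (hj1.trans ?_) (by positivity)
        gcongr
        exact Real.sin_le_one θ
      _ = Real.pi := by field_simp
  have hclose : ∀ x : ℝ, |x| * X ^ m ≤ Real.pi → 2 * (2 * m + 1 : ℕ) * |x| < Real.pi := by
    intro x hx
    push_cast
    rcases (abs_nonneg x).eq_or_lt with h0 | h0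
    · rw [← h0]; linarith
    · nlinarith
  obtain hψ | hψ := le_total (2 * θ) (Real.pi / 2)
  · have hδ' : |2 * θ - Real.pi * (2 * j : ℤ) / (2 * m + 1 : ℕ)| * X ^ m ≤ Real.pi := by
      convert hδ using 5
      push_cast
      ring
    obtain ⟨b, hb, hb2, hcop⟩ := coprime_of_close_rational_angle hm (b := 2 * j) (by omega)
      (by linarith) hψ (hclose _ hδ')
    rw [hb, Int.cast_natCast] at hδ'
    refine ⟨b, Y - 2 * X, 2 * θ, _, hb2, hcop, ?_, (add_sub_cancel _ _).symm, hδ'⟩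
    rw [Real.cos_two_mul]
    push_cast
    rw [hθ]
    ring
  · have hδ' : |(Real.pi - 2 * θ) - Real.pi * (2 * m + 1 - 2 * j : ℤ) / (2 * m + 1 : ℕ)| * X ^ m ≤
        Real.pi := by
      rw [← abs_neg] at hδ
      convert hδ using 3
      push_cast
      field_simp
      ring
    obtain ⟨b, hb, hb2, hcop⟩ := coprime_of_close_rational_angle hm (b := 2 * m + 1 - 2 * j)
      (by omega) (by linarith) (by linarith) (hclose _ hδ')
    rw [hb, Int.cast_natCast] at hδ'
    refine ⟨b, 2 * X - Y, Real.pi - 2 * θ, _, hb2, hcop, ?_, (add_sub_cancel _ _).symm, hδ'⟩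
    rw [Real.cos_pi_sub, Real.cos_two_mul]
    push_cast
    rw [hθ]
    ring

theorem abs_ThueF_ne {X : ℤ} (Y : ℤ) {m : ℕ} (hX : 2 ^ 17 ≤ X) (hm : (2 * m + 1).Prime)
    (hm1 : 21933 ≤ m) (hm2 : m ≤ 328965) : |ThueF X Y m| ≠ 2 * m + 1 := by
  intro h
  lift X to ℕ using le_trans (by norm_num) hX
  have hX' : 2 ^ 17 ≤ X := by exact_mod_cast hX
  set e := Nat.log 2 X with he
  have he17 : 17 ≤ e := Nat.le_log_of_pow_le one_lt_two hX'
  have h1 : 2 ^ e ≤ X := Nat.pow_log_le_self 2 (by omega)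
  have h2 : X < 2 ^ (e + 1) := Nat.lt_pow_succ_log_self one_lt_two X
  have h3 : 2 ^ 34 ≤ X ^ m := by
    calc 2 ^ 34 = (2 ^ 17) ^ 2 := by norm_num
      _ ≤ X ^ 2 := Nat.pow_le_pow_left hX' 2
      _ ≤ X ^ m := Nat.pow_le_pow_right (by omega) (by omega)
  obtain ⟨b, c, ψ, δ, hb, hcop, hc, hψ, hδ⟩ := exists_close_rational_angle (X := (X : ℤ))
    (by omega) hm (by
      have : ((2 ^ 34 : ℕ) : ℤ) ≤ X ^ m := by exact_mod_cast h3
      omega) h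
  have h4 := not_exists_close_rational_angle he17 (by exact_mod_cast h1) (by exact_mod_cast h2)
    (by omega) (by omega) hb hcop hc hψ
  have h5 : (2 : ℝ) ^ (21933 * e) ≤ (X : ℤ) ^ m := by
    have : 2 ^ (21933 * e) ≤ X ^ m := by
      calc 2 ^ (21933 * e) ≤ 2 ^ (e * m) :=
            Nat.pow_le_pow_right two_pos (by rw [mul_comm]; gcongr)
        _ = (2 ^ e) ^ m := pow_mul _ _ _
        _ ≤ X ^ m := Nat.pow_le_pow_left h1 m
    exact_mod_cast this
  exact absurd ((mul_le_mul_of_nonneg_left h5 (abs_nonneg δ)).trans hδ) (not_le.2 h4)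

theorem no_prime_power_solutions_for_large_exceptional_primes :
    (¬∃ (p : ℕ) (Y : ℤ), p.Prime ∧
      (ThueF ((p : ℤ) ^ 17) Y 21933 = 43867 ∨ ThueF ((p : ℤ) ^ 17) Y 21933 = -43867)) ∧
    (¬∃ (p : ℕ) (Y : ℤ), p.Prime ∧
      (ThueF ((p : ℤ) ^ 25) Y 328965 = 657931 ∨ ThueF ((p : ℤ) ^ 25) Y 328965 = -657931)) := by
  constructor
  · rintro ⟨p, Y, hp, h⟩
    have hp2 : (2 : ℤ) ≤ p := by exact_mod_cast hp.two_le
    refine abs_ThueF_ne Y (X := (p : ℤ) ^ 17) (m := 21933) (pow_le_pow_left₀ (by norm_num) hp2 17)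
      (by norm_num) le_rfl (by norm_num) ?_
    generalize ThueF ((p : ℤ) ^ 17) Y 21933 = F at h
    obtain rfl | rfl := h <;> norm_num
  · rintro ⟨p, Y, hp, h⟩
    have hp2 : (2 : ℤ) ≤ p := by exact_mod_cast hp.two_le
    refine abs_ThueF_ne Y (X := (p : ℤ) ^ 25) (m := 328965)
      ((pow_le_pow_right₀ one_le_two (by norm_num)).trans
        (pow_le_pow_left₀ (by norm_num) hp2 25))
      (by norm_num) (by norm_num) le_rfl ?_
    generalize ThueF ((p : ℤ) ^ 25) Y 328965 = F at h
    obtain rfl | rfl := h <;> norm_num
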